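/- arXiv:1402.0845 — 3 statements merged into one kernel-verified Lean document; each statement's English description precedes it below -/
import Mathlib

section
/- Let g : ℝ → [0,∞) be a log-concave probability density function, i.e. g is integrable with ∫_ℝ g(t) dt = 1 and g(λx + (1−λ)y) ≥ g(x)^λ · g(y)^{1−λ} for all x, y ∈ ℝ and λ ∈ [0,1]. Then the cumulative distribution function G(z) = ∫_{−∞}^z g(t) dt is log-concave: G(λx + (1−λ)y) ≥ G(x)^λ · G(y)^{1−λ} for all x, y ∈ ℝ and λ ∈ [0,1]. -/
open MeasureTheory

/-- For a log-concave function, moving two points symmetrically towards each other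
does not decrease the product of the values. -/
lemma mul_le_mul_of_log_concave {g : ℝ → ℝ} (hg0 : ∀ t, 0 ≤ g t)
    (hlc : ∀ x y l : ℝ, 0 ≤ l → l ≤ 1 →
      g x ^ l * g y ^ (1 - l) ≤ g (l * x + (1 - l) * y))
    {p q h : ℝ} (hh : 0 ≤ h) (hpq : p < q) (hq : h ≤ q - p) :
    g p * g q ≤ g (p + h) * g (q - h) := by
  have hd : 0 < q - p := sub_pos.2 hpq
  obtain ⟨r, hr⟩ : ∃ r, r = h / (q - p) := ⟨_, rfl⟩
  have hrh : r * (q - p) = h := by rw [hr]; field_simp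
  have hr0 : 0 ≤ r := hr ▸ div_nonneg hh hd.le
  have hr1 : r ≤ 1 := hr ▸ (div_le_one hd).2 hq
  have h1 := hlc q p r hr0 hr1
  have h2 := hlc p q r hr0 hr1
  rw [show r * q + (1 - r) * p = p + h by rw [← hrh]; ring] at h1
  rw [show r * p + (1 - r) * q = q - h by rw [← hrh]; ring] at h2
  have split (t : ℝ) : g t ^ r * g t ^ (1 - r) = g t := by
    rw [← Real.rpow_add_of_nonneg (hg0 t) hr0 (sub_nonneg.2 hr1), add_sub_cancel,
      Real.rpow_one]
  calc g p * g q = (g p ^ r * g p ^ (1 - r)) * (g q ^ r * g q ^ (1 - r)) := by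
        rw [split, split]
    _ = (g q ^ r * g p ^ (1 - r)) * (g p ^ r * g q ^ (1 - r)) := by ring
    _ ≤ g (p + h) * g (q - h) := mul_le_mul h1 h2
        (mul_nonneg (Real.rpow_nonneg (hg0 _) _) (Real.rpow_nonneg (hg0 _) _)) (hg0 _)

/-- Midpoint log-concavity of the primitive of a log-concave function. -/
lemma integral_Iic_mul_le_sq_of_log_concave {g : ℝ → ℝ} (hg0 : ∀ t, 0 ≤ g t)
    (hint : Integrable g)
    (hlc : ∀ x y l : ℝ, 0 ≤ l → l ≤ 1 →
      g x ^ l * g y ^ (1 - l) ≤ g (l * x + (1 - l) * y))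
    (m : ℝ) {h : ℝ} (hh : 0 ≤ h) :
    (∫ t in Set.Iic (m - h), g t) * (∫ t in Set.Iic (m + h), g t)
      ≤ (∫ t in Set.Iic m, g t) ^ 2 := by
  have hsplit (a b : ℝ) (hab : a ≤ b) : ∫ t in Set.Iic b, g t =
      (∫ t in Set.Iic a, g t) + ∫ t in Set.Ioc a b, g t := by
    rw [← Set.Iic_union_Ioc_eq_Iic hab]
    exact setIntegral_union (Set.Iic_disjoint_Ioc le_rfl) measurableSet_Ioc
      hint.integrableOn hint.integrableOn
  have hA : ∫ u in Set.Iic m, g (u - h) = ∫ t in Set.Iic (m - h), g t := by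
    have := (measurePreserving_sub_right volume h).setIntegral_preimage_emb
      (measurableEmbedding_subRight h) g (Set.Iic (m - h))
    simpa using this
  have hC : ∫ v in Set.Ioc (m - h) m, g (v + h) = ∫ t in Set.Ioc m (m + h), g t := by
    have := (measurePreserving_add_right volume h).setIntegral_preimage_emb
      (measurableEmbedding_addRight h) g (Set.Ioc m (m + h))
    simpa using this
  have key : (∫ u in Set.Iic m, g (u - h)) * (∫ v in Set.Ioc (m - h) m, g (v + h)) ≤
      (∫ u in Set.Iic m, g u) * (∫ v in Set.Ioc (m - h) m, g v) := by
    rw [← setIntegral_prod_mul, ← setIntegral_prod_mul]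
    refine setIntegral_mono_on
      ((hint.comp_sub_right h).mul_prod (hint.comp_add_right h)).integrableOn
      (hint.mul_prod hint).integrableOn (measurableSet_Iic.prod measurableSet_Ioc) ?_
    rintro ⟨u, v⟩ ⟨hu, hv⟩
    simp only [Set.mem_Iic, Set.mem_Ioc] at hu hv
    have := mul_le_mul_of_log_concave hg0 hlc (p := u - h) (q := v + h) hh
      (by linarith) (by linarith)
    simpa using this
  rw [hA, hC] at key
  have h1 := hsplit (m - h) m (by linarith)
  have h2 := hsplit m (m + h) (by linarith)
  rw [h2]
  rw [eq_sub_of_add_eq' h1.symm] at key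
  linarith

/-- A continuous midpoint-concave function on `[0, 1]` lies above its chord. -/
lemma chord_le_of_midpoint_concave {f : ℝ → ℝ} (hf : ContinuousOn f (Set.Icc 0 1))
    (hmid : ∀ a ∈ Set.Icc (0 : ℝ) 1, ∀ b ∈ Set.Icc (0 : ℝ) 1,
      f a + f b ≤ 2 * f ((a + b) / 2))
    {l : ℝ} (hl : l ∈ Set.Icc (0 : ℝ) 1) :
    l * f 1 + (1 - l) * f 0 ≤ f l := by
  have hc : ContinuousOn (fun t ↦ f t - (t * f 1 + (1 - t) * f 0)) (Set.Icc 0 1) :=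
    hf.sub (by fun_prop)
  obtain ⟨t, ⟨ht0, ht1⟩, hmin⟩ := isCompact_Icc.exists_isMinOn ⟨l, hl⟩ hc
  rw [isMinOn_iff] at hmin
  have hml := hmin l hl
  suffices 0 ≤ f t - (t * f 1 + (1 - t) * f 0) by linarith
  rcases le_total t (1 / 2) with h | h
  · have hs : 2 * t ∈ Set.Icc (0 : ℝ) 1 := ⟨by linarith, by linarith⟩
    have h1 := hmid 0 (by simp) (2 * t) hs
    have h2 := hmin (2 * t) hs
    rw [show (0 + 2 * t) / 2 = t by ring] at h1
    linarith
  · have hs : 2 * t - 1 ∈ Set.Icc (0 : ℝ) 1 := ⟨by linarith, by linarith⟩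
    have h1 := hmid 1 (by simp) (2 * t - 1) hs
    have h2 := hmin (2 * t - 1) hs
    rw [show (1 + (2 * t - 1)) / 2 = t by ring] at h1
    linarith

/-- A continuous monotone nonnegative midpoint-log-concave function is log-concave. -/
lemma log_concave_of_midpoint {G : ℝ → ℝ} (hG0 : ∀ z, 0 ≤ G z) (hmono : Monotone G)
    (hcont : Continuous G)
    (hmid : ∀ m h : ℝ, 0 ≤ h → G (m - h) * G (m + h) ≤ G m ^ 2)
    (x y l : ℝ) (hl0 : 0 ≤ l) (hl1 : l ≤ 1) :
    G x ^ l * G y ^ (1 - l) ≤ G (l * x + (1 - l) * y) := by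
  rcases hl0.eq_or_lt with rfl | hl0'
  · simp
  rcases hl1.eq_or_lt with rfl | hl1'
  · simp
  rcases (hG0 x).eq_or_lt with hx | hx
  · rw [← hx, Real.zero_rpow hl0'.ne', zero_mul]
    exact hG0 _
  rcases (hG0 y).eq_or_lt with hy | hy
  · rw [← hy, Real.zero_rpow (sub_pos.2 hl1').ne', mul_zero]
    exact hG0 _
  have hpos : ∀ t ∈ Set.Icc (0 : ℝ) 1, 0 < G (t * x + (1 - t) * y) := by
    rintro t ⟨h0, h1⟩
    rcases le_total x y with h | h
    · exact hx.trans_le (hmono (by nlinarith))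
    · exact hy.trans_le (hmono (by nlinarith))
  have hmid' (a b : ℝ) : G a * G b ≤ G ((a + b) / 2) ^ 2 := by
    rcases le_total a b with h | h
    · have := hmid ((a + b) / 2) ((b - a) / 2) (by linarith)
      rwa [show (a + b) / 2 - (b - a) / 2 = a by ring,
        show (a + b) / 2 + (b - a) / 2 = b by ring] at this
    · have := hmid ((a + b) / 2) ((a - b) / 2) (by linarith)
      rwa [show (a + b) / 2 - (a - b) / 2 = b by ring,
        show (a + b) / 2 + (a - b) / 2 = a by ring, mul_comm] at this
  have key := chord_le_of_midpoint_concave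
    (f := fun t ↦ Real.log (G (t * x + (1 - t) * y)))
    (ContinuousOn.log (by fun_prop) fun t ht ↦ (hpos t ht).ne')
    (fun a ha b hb ↦ by
      rw [← Real.log_mul (hpos a ha).ne' (hpos b hb).ne']
      have h := Real.log_le_log (mul_pos (hpos a ha) (hpos b hb)) (hmid' _ _)
      rw [Real.log_pow] at h
      convert h using 4
      · norm_num
      · ring_nf)
    (l := l) ⟨hl0, hl1⟩
  have hz := hpos l ⟨hl0, hl1⟩
  simp only [one_mul, sub_self, zero_mul, add_zero, sub_zero, zero_add] at key
  rw [← Real.log_le_log_iff (mul_pos (Real.rpow_pos_of_pos hx _) (Real.rpow_pos_of_pos hy _)) hz,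
    Real.log_mul (Real.rpow_pos_of_pos hx _).ne' (Real.rpow_pos_of_pos hy _).ne',
    Real.log_rpow hx, Real.log_rpow hy]
  exact key

/-- The CDF of a log-concave probability density on ℝ is log-concave. -/
theorem cdf_of_log_concave_density_log_concave
    (g : ℝ → ℝ) (hg0 : ∀ t, 0 ≤ g t)
    (hint : Integrable g)
    (htot : (∫ t, g t) = 1)
    (hlc : ∀ x y l : ℝ, 0 ≤ l → l ≤ 1 →
      g x ^ l * g y ^ (1 - l) ≤ g (l * x + (1 - l) * y))
    (G : ℝ → ℝ) (hG : ∀ z, G z = ∫ t in Set.Iic z, g t) :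
    ∀ x y l : ℝ, 0 ≤ l → l ≤ 1 →
      G x ^ l * G y ^ (1 - l) ≤ G (l * x + (1 - l) * y) := by
  refine log_concave_of_midpoint (fun z ↦ ?_) (fun a b hab ↦ ?_) ?_ (fun m h hh ↦ ?_)
  · rw [hG]
    exact integral_nonneg hg0
  · rw [hG, hG]
    exact setIntegral_mono_set hint.integrableOn (ae_of_all _ hg0)
      (Set.Iic_subset_Iic.2 hab).eventuallyLE
  · have h (z : ℝ) : G z = (∫ t in Set.Iic 0, g t) + ∫ t in (0 : ℝ)..z, g t := by
      rw [hG, ← intervalIntegral.integral_Iic_sub_Iic hint.integrableOn hint.integrableOn]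
      ring
    rw [funext h]
    exact continuous_const.add
      (intervalIntegral.continuous_primitive (fun _ _ ↦ hint.intervalIntegrable) 0)
  · simp only [hG]
    exact integral_Iic_mul_le_sq_of_log_concave hg0 hint hlc m hh
end

section
/- Let g : ℝ → [0,∞) be a log-concave probability density function, i.e. g is integrable with ∫_ℝ g(t) dt = 1 and g(λx + (1−λ)y) ≥ g(x)^λ · g(y)^{1−λ} for all x, y ∈ ℝ and λ ∈ [0,1]. Then the survivor function 1 − G, where G(z) = ∫_{−∞}^z g(t) dt, is log-concave: (1 − G)(λx + (1−λ)y) ≥ (1 − G)(x)^λ · (1 − G)(y)^{1−λ} for all x, y ∈ ℝ and λ ∈ [0,1]. -/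
open MeasureTheory

/-- A log-concave function satisfies the exchange inequality `g u * g (v + t) ≤ g v * g (u + t)`
for `u ≤ v` and `0 < t`. -/
lemma logConcave_mul_le_mul_swap {g : ℝ → ℝ} (hg0 : ∀ t, 0 ≤ g t)
    (hlc : ∀ x y l : ℝ, 0 ≤ l → l ≤ 1 →
      g x ^ l * g y ^ (1 - l) ≤ g (l * x + (1 - l) * y))
    {u v t : ℝ} (huv : u ≤ v) (ht : 0 < t) :
    g u * g (v + t) ≤ g v * g (u + t) := by
  have hpos : 0 < v + t - u := by linarith
  set l := t / (v + t - u) with hl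
  have hl0 : 0 ≤ l := by positivity
  have hl1 : l ≤ 1 := by rw [hl, div_le_one hpos]; linarith
  have hlt : l * (v + t - u) = t := by rw [hl]; field_simp
  have h1 := hlc u (v + t) l hl0 hl1
  have h2 := hlc u (v + t) (1 - l) (by linarith) (by linarith)
  rw [show l * u + (1 - l) * (v + t) = v by linarith] at h1
  rw [show (1 - l) * u + (1 - (1 - l)) * (v + t) = u + t by linarith, sub_sub_cancel] at h2
  have rpow_split : ∀ a : ℝ, 0 ≤ a → a ^ l * a ^ (1 - l) = a := fun a ha => by
    rw [← Real.rpow_add_of_nonneg ha hl0 (by linarith), add_sub_cancel, Real.rpow_one]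
  calc g u * g (v + t)
      = (g u ^ l * g u ^ (1 - l)) * (g (v + t) ^ l * g (v + t) ^ (1 - l)) := by
        rw [rpow_split _ (hg0 _), rpow_split _ (hg0 _)]
    _ = (g u ^ l * g (v + t) ^ (1 - l)) * (g u ^ (1 - l) * g (v + t) ^ l) := by ring
    _ ≤ g v * g (u + t) := mul_le_mul h1 h2
        (mul_nonneg (Real.rpow_nonneg (hg0 _) _) (Real.rpow_nonneg (hg0 _) _)) (hg0 _)

lemma setIntegral_Ioi_eq_integral_add (g : ℝ → ℝ) (z : ℝ) :
    ∫ t in Set.Ioi z, g t = ∫ t in Set.Ioi 0, g (z + t) := by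
  have h := (measurePreserving_add_left volume z).setIntegral_preimage_emb
    (measurableEmbedding_addLeft z) g (Set.Ioi z)
  rw [← h]
  simp

/-- The hazard rate of a log-concave density is monotone, in cross-multiplied form. -/
lemma logConcave_mul_setIntegral_Ioi_le {g : ℝ → ℝ} (hg0 : ∀ t, 0 ≤ g t)
    (hint : Integrable g)
    (hlc : ∀ x y l : ℝ, 0 ≤ l → l ≤ 1 →
      g x ^ l * g y ^ (1 - l) ≤ g (l * x + (1 - l) * y))
    {u v : ℝ} (huv : u ≤ v) :
    g u * ∫ t in Set.Ioi v, g t ≤ g v * ∫ t in Set.Ioi u, g t := by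
  rw [setIntegral_Ioi_eq_integral_add g u, setIntegral_Ioi_eq_integral_add g v,
    ← integral_const_mul, ← integral_const_mul]
  exact setIntegral_mono_on ((hint.comp_add_left v).const_mul _).integrableOn
    ((hint.comp_add_left u).const_mul _).integrableOn measurableSet_Ioi
    fun t ht => logConcave_mul_le_mul_swap hg0 hlc huv ht

lemma setIntegral_Ioi_eq_add {g : ℝ → ℝ} (hint : Integrable g) {a b : ℝ} (hab : a ≤ b) :
    ∫ t in Set.Ioi a, g t = (∫ t in Set.Ioc a b, g t) + ∫ t in Set.Ioi b, g t := by
  rw [← Set.Ioc_union_Ioi_eq_Ioi hab]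
  exact setIntegral_union Set.Ioc_disjoint_Ioi_same measurableSet_Ioi
    hint.integrableOn hint.integrableOn

/-- A discrete differential inequality along rays from `m` gives an exponential bound. -/
lemma mul_exp_le_of_mul_one_add_le {S : ℝ → ℝ} {m c : ℝ}
    (hstep : ∀ z w, (m ≤ z ∧ z ≤ w) ∨ (w ≤ z ∧ z ≤ m) → S w * (1 + c * (w - z)) ≤ S z)
    (d : ℝ) : S (m + d) * Real.exp (c * d) ≤ S m := by
  have hlim := (Real.tendsto_one_add_div_pow_exp (c * d)).const_mul (S (m + d))
  refine le_of_tendsto hlim ?_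
  obtain ⟨N, hN⟩ := exists_nat_gt |c * d|
  filter_upwards [Filter.eventually_ge_atTop (N + 1)] with n hn
  have hNn : (N : ℝ) + 1 ≤ n := by exact_mod_cast hn
  have hn0 : (0 : ℝ) < n := by linarith [abs_nonneg (c * d)]
  have hfac : 0 ≤ 1 + c * d / n := by
    have : -1 ≤ c * d / n := by
      rw [le_div_iff₀ hn0]
      linarith [neg_abs_le (c * d)]
    linarith
  have key : ∀ k : ℕ, S (m + k * (d / n)) * (1 + c * d / n) ^ k ≤ S m := by
    intro k
    induction k with
    | zero => simp
    | succ k ih =>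
      refine le_trans ?_ ih
      rw [pow_succ', ← mul_assoc]
      refine mul_le_mul_of_nonneg_right ?_ (pow_nonneg hfac k)
      have hk : (0 : ℝ) ≤ k := k.cast_nonneg
      have h := hstep (m + k * (d / n)) (m + (k + 1 : ℕ) * (d / n)) (by
        push_cast
        rcases le_total 0 d with hd | hd
        · have h1 : 0 ≤ d / n := div_nonneg hd hn0.le
          have h2 := mul_nonneg hk h1
          exact Or.inl ⟨by linarith, by linarith⟩
        · have h1 : d / n ≤ 0 := div_nonpos_of_nonpos_of_nonneg hd hn0.le
          have h2 := mul_nonpos_of_nonneg_of_nonpos hk h1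
          exact Or.inr ⟨by linarith, by linarith⟩)
      rwa [show c * (m + (k + 1 : ℕ) * (d / n) - (m + k * (d / n))) = c * d / n by
        push_cast; ring] at h
  have h := key n
  rwa [mul_div_cancel₀ d hn0.ne'] at h

/-- Tangent-line bound for the logarithm of the tail integral of a log-concave function. -/
lemma logConcave_setIntegral_Ioi_mul_exp_le {g : ℝ → ℝ} (hg0 : ∀ t, 0 ≤ g t)
    (hint : Integrable g)
    (hlc : ∀ x y l : ℝ, 0 ≤ l → l ≤ 1 →
      g x ^ l * g y ^ (1 - l) ≤ g (l * x + (1 - l) * y))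
    {m : ℝ} (hm : 0 < ∫ t in Set.Ioi m, g t) (d : ℝ) :
    (∫ t in Set.Ioi (m + d), g t) * Real.exp (g m / (∫ t in Set.Ioi m, g t) * d) ≤
      ∫ t in Set.Ioi m, g t := by
  have hanti : ∀ a b : ℝ, a ≤ b → ∫ t in Set.Ioi b, g t ≤ ∫ t in Set.Ioi a, g t :=
    fun a b hab => setIntegral_mono_set hint.integrableOn
      (Filter.Eventually.of_forall hg0) (Set.Ioi_subset_Ioi hab).eventuallyLE
  have hc0 : 0 ≤ g m / (∫ t in Set.Ioi m, g t) := div_nonneg (hg0 m) hm.le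
  refine mul_exp_le_of_mul_one_add_le (S := fun z => ∫ t in Set.Ioi z, g t) ?_ d
  rintro z w (⟨hmz, hzw⟩ | ⟨hwz, hzm⟩)
  · have hlow : ∀ t ∈ Set.Ioc z w,
        g m / (∫ t in Set.Ioi m, g t) * (∫ t in Set.Ioi w, g t) ≤ g t := fun t ht => by
      have h := logConcave_mul_setIntegral_Ioi_le hg0 hint hlc (hmz.trans ht.1.le)
      rw [div_mul_eq_mul_div, div_le_iff₀ hm]
      exact (mul_le_mul_of_nonneg_left (hanti t w ht.2) (hg0 m)).trans h
    have h := setIntegral_mono_on (integrableOn_const (by simp)) hint.integrableOn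
      measurableSet_Ioc hlow
    rw [setIntegral_const, Real.volume_real_Ioc_of_le hzw, smul_eq_mul] at h
    have hsplit := setIntegral_Ioi_eq_add hint hzw
    linarith
  · have hup : ∀ t ∈ Set.Ioc w z,
        g t ≤ g m / (∫ t in Set.Ioi m, g t) * (∫ t in Set.Ioi w, g t) := fun t ht => by
      have h := logConcave_mul_setIntegral_Ioi_le hg0 hint hlc (ht.2.trans hzm)
      rw [div_mul_eq_mul_div, le_div_iff₀ hm]
      exact h.trans (mul_le_mul_of_nonneg_left (hanti w t ht.1.le) (hg0 m))
    have h := setIntegral_mono_on hint.integrableOn (integrableOn_const (by simp))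
      measurableSet_Ioc hup
    rw [setIntegral_const, Real.volume_real_Ioc_of_le hwz, smul_eq_mul] at h
    have hsplit := setIntegral_Ioi_eq_add hint hwz
    linarith

/-- The survivor function of a log-concave probability density on ℝ is log-concave. -/
theorem survivor_of_log_concave_density_log_concave
    (g : ℝ → ℝ) (hg0 : ∀ t, 0 ≤ g t)
    (hint : Integrable g)
    (htot : (∫ t, g t) = 1)
    (hlc : ∀ x y l : ℝ, 0 ≤ l → l ≤ 1 →
      g x ^ l * g y ^ (1 - l) ≤ g (l * x + (1 - l) * y))
    (G : ℝ → ℝ) (hG : ∀ z, G z = ∫ t in Set.Iic z, g t) :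
    ∀ x y l : ℝ, 0 ≤ l → l ≤ 1 →
      (1 - G x) ^ l * (1 - G y) ^ (1 - l) ≤ 1 - G (l * x + (1 - l) * y) := by
  intro x y l hl0 hl1
  have hS : ∀ z, 1 - G z = ∫ t in Set.Ioi z, g t := fun z => by
    have h := integral_add_compl (measurableSet_Iic (a := z)) hint
    rw [Set.compl_Iic] at h
    rw [hG]
    linarith
  have hS0 : ∀ z, 0 ≤ ∫ t in Set.Ioi z, g t := fun z =>
    setIntegral_nonneg measurableSet_Ioi fun t _ => hg0 t
  simp only [hS]
  set m := l * x + (1 - l) * y with hmdef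
  rcases (hS0 m).eq_or_lt with hm | hm
  · have hzero : ∀ z, m ≤ z → ∫ t in Set.Ioi z, g t = 0 := fun z hz =>
      le_antisymm (hm ▸ setIntegral_mono_set hint.integrableOn
        (Filter.Eventually.of_forall hg0) (Set.Ioi_subset_Ioi hz).eventuallyLE) (hS0 z)
    rcases hl0.eq_or_lt with rfl | hl0'
    · simp [hmdef]
    rcases hl1.eq_or_lt with rfl | hl1'
    · simp [hmdef]
    rw [← hm]
    rcases le_total m y with hy | hy
    · rw [hzero y hy, Real.zero_rpow (by linarith), mul_zero]
    · have hx : m ≤ x := by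
        by_contra! hx
        nlinarith
      rw [hzero x hx, Real.zero_rpow hl0'.ne', zero_mul]
  · have hbound : ∀ z, ∫ t in Set.Ioi z, g t ≤ (∫ t in Set.Ioi m, g t) *
        Real.exp (g m / (∫ t in Set.Ioi m, g t) * (m - z)) := fun z => by
      have h := logConcave_setIntegral_Ioi_mul_exp_le hg0 hint hlc hm (z - m)
      rw [add_sub_cancel, ← le_div_iff₀ (Real.exp_pos _), div_eq_mul_inv, ← Real.exp_neg] at h
      rwa [← mul_neg, neg_sub] at h
    set s := ∫ t in Set.Ioi m, g t
    set c := g m / s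
    calc _ ≤ (s * Real.exp (c * (m - x))) ^ l * (s * Real.exp (c * (m - y))) ^ (1 - l) :=
          mul_le_mul (Real.rpow_le_rpow (hS0 x) (hbound x) hl0)
            (Real.rpow_le_rpow (hS0 y) (hbound y) (by linarith))
            (Real.rpow_nonneg (hS0 y) _) (by positivity)
      _ = (s ^ l * s ^ (1 - l)) * Real.exp (c * (m - x) * l + c * (m - y) * (1 - l)) := by
          rw [Real.mul_rpow hm.le (Real.exp_pos _).le, Real.mul_rpow hm.le (Real.exp_pos _).le,
            ← Real.exp_mul, ← Real.exp_mul, Real.exp_add]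
          ring
      _ = s := by
          rw [← Real.rpow_add hm, add_sub_cancel, Real.rpow_one,
            show c * (m - x) * l + c * (m - y) * (1 - l) = 0 by rw [hmdef]; ring,
            Real.exp_zero, mul_one]
end

section
/- Let (x_i, y_i), i = 1,…,n, be data with x_i ∈ ℝ^d and y_i ∈ {0,1}, let Δ ∈ ℝ^d, and set x_i* = x_i − y_i·Δ. Let G : ℝ → ℝ be nondecreasing with 0 < G(z) < 1 for all z, and define ℓ(α,β) = Σ_{i=1}^n [y_i·log G(α + βᵀx_i) + (1 − y_i)·log(1 − G(α + βᵀx_i))] and ℓ*(α,β) = Σ_{i=1}^n [y_i·log G(α + βᵀx_i*) + (1 − y_i)·log(1 − G(α + βᵀx_i*))]. If β ∈ ℝ^d satisfies βᵀΔ ≤ 0, then for every α ∈ ℝ, ℓ(α,β) ≤ ℓ*(α,β). -/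
open Finset

/-- Shifting the predictors of the `y=1` cases by `Δ` cannot decrease the binary
regression log-likelihood when `βᵀΔ ≤ 0` and `G` is nondecreasing. -/
theorem shifted_loglik_ge
    (n d : ℕ) (x : Fin n → Fin d → ℝ) (y : Fin n → ℝ)
    (hy : ∀ i, y i = 0 ∨ y i = 1)
    (Δ : Fin d → ℝ)
    (xs : Fin n → Fin d → ℝ) (hxs : ∀ i, xs i = x i - y i • Δ)
    (G : ℝ → ℝ) (hmono : Monotone G)
    (hG0 : ∀ z, 0 < G z) (hG1 : ∀ z, G z < 1)
    (β : Fin d → ℝ) (hβΔ : ∑ j, β j * Δ j ≤ 0) (α : ℝ) :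
    ∑ i, (y i * Real.log (G (α + ∑ j, β j * x i j))
        + (1 - y i) * Real.log (1 - G (α + ∑ j, β j * x i j)))
    ≤ ∑ i, (y i * Real.log (G (α + ∑ j, β j * xs i j))
        + (1 - y i) * Real.log (1 - G (α + ∑ j, β j * xs i j))) := by
  refine Finset.sum_le_sum fun i _ => ?_
  rcases hy i with h | h
  · simp [hxs, h]
  · have hle : ∑ j, β j * x i j ≤ ∑ j, β j * xs i j := by
      simp only [hxs, h, one_smul, Pi.sub_apply, mul_sub, Finset.sum_sub_distrib]
      linarith
    simpa [h] using Real.log_le_log (hG0 _) (hmono (add_le_add_right hle α))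
end
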